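/- arXiv:1905.00791 — 2 statements merged into one kernel-verified Lean document; each statement's English description precedes it below -/
import Mathlib

section
/- Every geometric spanning tree T on a set P of n ≥ 3 points in the plane in convex position (and in general position) can be transformed, by at most two flips, into a spanning tree that contains a boundary edge, i.e., an edge {p,q} such that all points of P \ {p,q} lie strictly on one side of the line through p and q. -/
open EuclideanGeometry Real

noncomputable section

/-- Points of the Euclidean plane. -/
abbrev Pt : Type := EuclideanSpace ℝ (Fin 2)

/-- Two closed segments `ab` and `cd` on four distinct points *cross* if their open
segments have a common point. -/
def SegCross (a b c d : Pt) : Prop :=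
  a ≠ b ∧ a ≠ c ∧ a ≠ d ∧ b ≠ c ∧ b ≠ d ∧ c ≠ d ∧
    (openSegment ℝ a b ∩ openSegment ℝ c d).Nonempty

/-- No three distinct points of `P` are collinear. -/
def GenPos (P : Set Pt) : Prop :=
  ∀ p ∈ P, ∀ q ∈ P, ∀ r ∈ P, p ≠ q → p ≠ r → q ≠ r →
    ¬ Collinear ℝ ({p, q, r} : Set Pt)

/-- `P` is in convex position: no point lies in the convex hull of the others. -/
def ConvexPos (P : Set Pt) : Prop :=
  ∀ p ∈ P, p ∉ convexHull ℝ (P \ {p})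

/-- A geometric graph (on vertices `V` placed in the plane by `pos`) is plane if no two
of its edges cross. -/
def TreePlane {V : Type} (pos : V → Pt) (T : SimpleGraph V) : Prop :=
  ∀ a b c d : V, T.Adj a b → T.Adj c d → ¬ SegCross (pos a) (pos b) (pos c) (pos d)

/-- `T'` is obtained from the spanning tree `T` by a single flip: two crossing edges
`{a,b}`, `{c,d}` are removed, and two edges on the same four points are added so that
the result is again a spanning tree. -/
def TreeFlip {V : Type} (pos : V → Pt) (T T' : SimpleGraph V) : Prop :=
  ∃ a b c d : V, T.Adj a b ∧ T.Adj c d ∧ SegCross (pos a) (pos b) (pos c) (pos d) ∧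
    ∃ e₁ e₂ : Sym2 V,
      e₁ ∈ ({s(a, c), s(a, d), s(b, c), s(b, d)} : Set (Sym2 V)) ∧
      e₂ ∈ ({s(a, c), s(a, d), s(b, c), s(b, d)} : Set (Sym2 V)) ∧ e₁ ≠ e₂ ∧
      T'.edgeSet = (T.edgeSet \ {s(a, b), s(c, d)}) ∪ {e₁, e₂} ∧ T'.IsTree

/-- `T` can be transformed into a plane spanning tree by at most `k` flips. -/
def TreeFlipsToPlane {V : Type} (pos : V → Pt) (T : SimpleGraph V) (k : ℕ) : Prop :=
  ∃ (j : ℕ) (g : ℕ → SimpleGraph V), j ≤ k ∧ g 0 = T ∧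
    (∀ i < j, TreeFlip pos (g i) (g (i + 1))) ∧ TreePlane pos (g j)

/-- `{p, q}` is a boundary edge of `P`: all other points of `P` lie strictly on one
side of the line through `p` and `q`. -/
def BoundaryEdge (P : Set Pt) (p q : Pt) : Prop :=
  p ≠ q ∧ ∀ x ∈ P \ {p, q}, ∀ y ∈ P \ {p, q},
    (affineSpan ℝ ({p, q} : Set Pt)).SSameSide x y

/-- Signed area (orientation) of the triangle `a b c`. -/
def Dt (a b c : Pt) : ℝ := (b 0 - a 0) * (c 1 - a 1) - (b 1 - a 1) * (c 0 - a 0)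

theorem Dt_rot (a b c : Pt) : Dt b c a = Dt a b c := by unfold Dt; ring

theorem Dt_swap (a b c : Pt) : Dt a c b = - Dt a b c := by unfold Dt; ring

theorem Dt_same (a b : Pt) : Dt a b b = 0 := by unfold Dt; ring

theorem mem_line_of_Dt {p q x : Pt} (h : p ≠ q) (hD : Dt p q x = 0) :
    x ∈ affineSpan ℝ ({p, q} : Set Pt) := by
  rw [mem_affineSpan_pair_iff_exists_lineMap_eq]
  unfold Dt at hD
  by_cases h0 : q 0 - p 0 = 0
  · have h1 : q 1 - p 1 ≠ 0 := by
      intro h1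
      apply h
      ext i
      fin_cases i
      · simp; linarith
      · simp; linarith
    refine ⟨(x 1 - p 1) / (q 1 - p 1), ?_⟩
    ext i
    fin_cases i
    · simp [AffineMap.lineMap_apply, h0]
      rw [h0] at hD
      have : (q 1 - p 1) * (x 0 - p 0) = 0 := by linarith
      have := (mul_eq_zero.1 this).resolve_left h1
      linarith
    · simp [AffineMap.lineMap_apply]
      field_simp
      ring
  · refine ⟨(x 0 - p 0) / (q 0 - p 0), ?_⟩
    ext i
    fin_cases i
    · simp [AffineMap.lineMap_apply]
      field_simp
      ring
    · simp [AffineMap.lineMap_apply]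
      field_simp
      linarith

theorem Dt_of_mem_line {p q x : Pt} (hx : x ∈ affineSpan ℝ ({p, q} : Set Pt)) :
    Dt p q x = 0 := by
  rw [mem_affineSpan_pair_iff_exists_lineMap_eq] at hx
  obtain ⟨r, rfl⟩ := hx
  simp [Dt, AffineMap.lineMap_apply]
  ring

theorem Dt_ne {P : Set Pt} (hgp : GenPos P) {p q r : Pt} (hp : p ∈ P) (hq : q ∈ P) (hr : r ∈ P)
    (h1 : p ≠ q) (h2 : p ≠ r) (h3 : q ≠ r) : Dt p q r ≠ 0 := by
  intro h
  apply hgp p hp q hq r hr h1 h2 h3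
  have := mem_line_of_Dt h1 h
  have h5 := collinear_insert_of_mem_affineSpan_pair this
  have : ({p, q, r} : Set Pt) = {r, p, q} := by
    ext y; simp; tauto
  rwa [this]

theorem no_inside {P : Set Pt} (hcv : ConvexPos P) {a b c d : Pt} (ha : a ∈ P) (hb : b ∈ P)
    (hc : c ∈ P) (hd : d ∈ P) (h1 : 0 < Dt a b c) (h2 : 0 < Dt a c d) (h3 : 0 < Dt a d b) :
    False := by
  have hba : b ≠ a := by rintro rfl; simp [Dt] at h1
  have hca : c ≠ a := by rintro rfl; simp [Dt] at h1
  have hda : d ≠ a := by rintro rfl; simp [Dt] at h2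
  apply hcv a ha
  have hS : 0 < Dt a b c + Dt a c d + Dt a d b := by positivity
  have hconv := convex_convexHull ℝ (P \ {a})
  have key := hconv.sum_mem (t := Finset.univ)
    (w := ![Dt a c d / (Dt a b c + Dt a c d + Dt a d b), Dt a d b / (Dt a b c + Dt a c d + Dt a d b),
      Dt a b c / (Dt a b c + Dt a c d + Dt a d b)]) (z := ![b, c, d])
    (by intro i _; fin_cases i <;> simp <;> positivity)
    (by simp [Fin.sum_univ_three]; field_simp; ring)
    (by
      intro i _
      apply subset_convexHull
      fin_cases i
      · exact ⟨hb, hba⟩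
      · exact ⟨hc, hca⟩
      · exact ⟨hd, hda⟩)
  convert key using 1
  ext i
  simp only [Fin.sum_univ_three]
  fin_cases i
  · simp
    field_simp
    unfold Dt
    ring
  · simp
    field_simp
    unfold Dt
    ring

theorem boundary_of_neg {P : Set Pt} {p q : Pt} (hpq : p ≠ q)
    (h : ∀ x ∈ P, x ≠ p → x ≠ q → Dt p q x < 0) : BoundaryEdge P p q := by
  refine ⟨hpq, ?_⟩
  rintro x ⟨hx, hx'⟩ y ⟨hy, hy'⟩
  simp only [Set.mem_insert_iff, Set.mem_singleton_iff, not_or] at hx' hy'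
  have hDx := h x hx hx'.1 hx'.2
  have hDy := h y hy hy'.1 hy'.2
  rw [AffineSubspace.sSameSide_iff_exists_left (left_mem_affineSpan_pair ℝ p q)]
  refine ⟨fun hm => hDx.ne (Dt_of_mem_line hm), fun hm => hDy.ne (Dt_of_mem_line hm),
    y - (Dt p q y / Dt p q x) • (x - p), ?_, ?_⟩
  · apply mem_line_of_Dt hpq
    have hne := hDx.ne
    have e : Dt p q (y - (Dt p q y / Dt p q x) • (x - p))
        = Dt p q y - (Dt p q y / Dt p q x) * Dt p q x := by
      generalize Dt p q y / Dt p q x = t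
      simp [Dt]
      ring
    rw [e]
    field_simp
    ring
  · have : y -ᵥ (y - (Dt p q y / Dt p q x) • (x - p)) = (Dt p q y / Dt p q x) • (x - p) := by
      simp
    rw [this]
    exact SameRay.sameRay_nonneg_smul_right _ (div_pos_of_neg_of_neg hDy hDx).le

theorem cross_of_Dt {i j q b : Pt} (h1 : 0 < Dt i j q) (h2 : Dt i j b < 0)
    (h3 : Dt q b i < 0) (h4 : 0 < Dt q b j) : SegCross i j q b := by
  have hij : i ≠ j := by rintro rfl; simp [Dt] at h1
  have hiq : i ≠ q := by rintro rfl; simp [Dt] at h1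
  have hib : i ≠ b := by rintro rfl; simp [Dt] at h2
  have hjq : j ≠ q := by rintro rfl; simp [Dt] at h4
  have hjb : j ≠ b := by rintro rfl; simp [Dt_same] at h4
  have hqb : q ≠ b := by rintro rfl; linarith
  refine ⟨hij, hiq, hib, hjq, hjb, hqb, ?_⟩
  have s1 : 0 < Dt i j q - Dt i j b := by linarith
  have s2 : 0 < Dt q b j - Dt q b i := by linarith
  have e : Dt i j q - Dt i j b = Dt q b j - Dt q b i := by unfold Dt; ring
  refine ⟨(Dt q b j / (Dt q b j - Dt q b i)) • i + (-Dt q b i / (Dt q b j - Dt q b i)) • j,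
    ⟨_, _, div_pos h4 s2, div_pos (by linarith) s2, ?_, rfl⟩,
    ⟨-Dt i j b / (Dt q b j - Dt q b i), Dt i j q / (Dt q b j - Dt q b i),
      div_pos (by linarith) s2, div_pos h1 s2, ?_, ?_⟩⟩
  · field_simp; ring
  · rw [← e]; field_simp; ring
  · have hne := s2.ne'
    ext k
    fin_cases k
    · simp
      field_simp
      unfold Dt
      ring
    · simp
      field_simp
      unfold Dt
      ring

theorem exchange {V : Type} [Finite V] (T : SimpleGraph V) (hT : T.IsTree) {p a q : V}
    (hpa : T.Adj p a) (hqp : q ≠ p) (hqa : q ≠ a) :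
    ∃ b, T.Adj q b ∧ ∃ T' : SimpleGraph V,
      T'.edgeSet = (T.edgeSet \ {s(p, a), s(q, b)}) ∪ {s(p, q), s(a, q)} ∧ T'.IsTree := by
  obtain ⟨w0, hw0⟩ := (hT.existsUnique_path q p).exists
  cases w0 with
  | nil => exact absurd rfl hqp
  | @cons _ b _ hqb w =>
    rw [SimpleGraph.Walk.cons_isPath_iff] at hw0
    refine ⟨b, hqb, ?_⟩
    have hes : (SimpleGraph.fromEdgeSet
        ((T.edgeSet \ {s(p, a), s(q, b)}) ∪ {s(p, q), s(a, q)})).edgeSet =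
        (T.edgeSet \ {s(p, a), s(q, b)}) ∪ {s(p, q), s(a, q)} := by
      rw [SimpleGraph.edgeSet_fromEdgeSet]
      ext e
      simp only [Set.mem_sdiff, and_iff_left_iff_imp]
      rintro (he | he | he)
      · exact fun hd => T.not_isDiag_of_mem_edgeSet he.1 hd
      · subst he; simpa using hqp.symm
      · rw [Set.mem_singleton_iff] at he; subst he; simpa using hqa.symm
    refine ⟨_, hes, ?_⟩
    set T' := SimpleGraph.fromEdgeSet
        ((T.edgeSet \ {s(p, a), s(q, b)}) ∪ {s(p, q), s(a, q)}) with hT'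
    have apq : T'.Adj p q := by
      rw [← SimpleGraph.mem_edgeSet, hes]; right; left; rfl
    have aaq : T'.Adj a q := by
      rw [← SimpleGraph.mem_edgeSet, hes]; right; right; rfl
    have step : ∀ u v, T.Adj u v → s(u, v) ≠ s(q, b) → T'.Reachable u v := by
      intro u v huv hne
      by_cases h : s(u, v) = s(p, a)
      · have hr : T'.Reachable p a := apq.reachable.trans aaq.symm.reachable
        rcases Sym2.eq_iff.1 h with ⟨rfl, rfl⟩ | ⟨rfl, rfl⟩
        · exact hr
        · exact hr.symm
      · apply SimpleGraph.Adj.reachable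
        rw [← SimpleGraph.mem_edgeSet, hes]
        left
        exact ⟨huv, by simp only [Set.mem_insert_iff, Set.mem_singleton_iff, not_or]; exact ⟨h, hne⟩⟩
    have walk : ∀ u v (w : T.Walk u v), q ∉ w.support → T'.Reachable u v := by
      intro u v w
      induction w with
      | nil => intro _; exact SimpleGraph.Reachable.refl _
      | @cons u v z h w ih =>
        intro hq
        simp only [SimpleGraph.Walk.support_cons, List.mem_cons, not_or] at hq
        refine (step u v h ?_).trans (ih hq.2)
        intro he
        have hv : v ≠ q := by
          rintro rfl
          exact hq.2 w.start_mem_support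
        rcases Sym2.eq_iff.1 he with ⟨h1, _⟩ | ⟨_, h2⟩
        · exact hq.1 h1.symm
        · exact hv h2
    have rqb : T'.Reachable q b := (apq.symm.reachable).trans (walk _ _ w hw0.2).symm
    have step2 : ∀ u v, T.Adj u v → T'.Reachable u v := by
      intro u v huv
      by_cases h : s(u, v) = s(q, b)
      · rcases Sym2.eq_iff.1 h with ⟨rfl, rfl⟩ | ⟨rfl, rfl⟩
        · exact rqb
        · exact rqb.symm
      · exact step u v huv h
    have walk2 : ∀ u v (w : T.Walk u v), T'.Reachable u v := by
      intro u v w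
      induction w with
      | nil => exact SimpleGraph.Reachable.refl _
      | cons h w ih => exact (step2 _ _ h).trans ih
    have hne : Nonempty V := ⟨p⟩
    have hconn : T'.Connected := ⟨fun u v => (hT.connected u v).elim (walk2 u v)⟩
    rw [SimpleGraph.isTree_iff_connected_and_card]
    refine ⟨hconn, le_antisymm ?_ hconn.card_vert_le_card_edgeSet_add_one⟩
    have hc := (SimpleGraph.isTree_iff_connected_and_card.1 hT).2
    rw [← hc, hes]
    have hneq : s(p, a) ≠ s(q, b) := by
      intro he
      rcases Sym2.eq_iff.1 he with ⟨h1, _⟩ | ⟨_, h2⟩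
      · exact hqp h1.symm
      · exact hqa h2.symm
    have hsub : ({s(p, a), s(q, b)} : Set (Sym2 V)) ⊆ T.edgeSet := by
      rintro e (he | he)
      · subst he; exact hpa
      · rw [Set.mem_singleton_iff] at he; subst he; exact hqb
    have h1 := Set.ncard_sdiff_add_ncard_of_subset hsub
    rw [Set.ncard_pair hneq] at h1
    have h2 := Set.ncard_union_le (T.edgeSet \ {s(p, a), s(q, b)}) {s(p, q), s(a, q)}
    have h3 : ({s(p, q), s(a, q)} : Set (Sym2 V)).ncard ≤ 2 := Set.ncard_insert_le _ _ |>.trans (by simp)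
    simp only [Nat.card_coe_set_eq]
    omega

/-- Points of `P` strictly to the left of the directed line `i j`. -/
def Lf (P : Finset Pt) (i j : Pt) : Finset Pt := by
  classical exact P.filter (fun x => 0 < Dt i j x)

theorem mem_Lf {P : Finset Pt} {i j x : Pt} : x ∈ Lf P i j ↔ x ∈ P ∧ 0 < Dt i j x := by
  simp [Lf]

theorem pos_or {P : Set Pt} (hgp : GenPos P) {p q r : Pt} (hp : p ∈ P) (hq : q ∈ P) (hr : r ∈ P)
    (h1 : p ≠ q) (h2 : r ≠ p) (h3 : r ≠ q) (h : ¬ 0 < Dt p q r) : Dt p q r < 0 :=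
  lt_of_le_of_ne (not_lt.1 h) (Dt_ne hgp hp hq hr h1 h2.symm h3.symm)

/-- Every geometric spanning tree on `n ≥ 3` points in convex (and
general) position can be transformed, by at most two flips, into a spanning tree
containing a boundary edge. -/
theorem stmt10 (n : ℕ) (h3 : 3 ≤ n) (P : Finset Pt) (hcard : P.card = n)
    (hgp : GenPos ↑P) (hcv : ConvexPos ↑P)
    (T : SimpleGraph {x : Pt // x ∈ P}) (hT : T.IsTree) :
    ∃ (j : ℕ) (g : ℕ → SimpleGraph {x : Pt // x ∈ P}), j ≤ 2 ∧ g 0 = T ∧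
      (∀ i < j, TreeFlip Subtype.val (g i) (g (i + 1))) ∧
      ∃ p q : {x : Pt // x ∈ P}, (g j).Adj p q ∧ BoundaryEdge ↑P ↑p ↑q := by
  classical
  by_cases hB : ∃ p q : {x : Pt // x ∈ P}, T.Adj p q ∧ BoundaryEdge ↑P ↑p ↑q
  · exact ⟨0, fun _ => T, by norm_num, rfl, by simp, hB⟩
  have hnt : Nontrivial {x : Pt // x ∈ P} := by
    rw [← Fintype.one_lt_card_iff_nontrivial, Fintype.card_coe]; omega
  -- a directed edge with the fewest points to its left
  obtain ⟨⟨i, j⟩, hij, hmin⟩ : ∃ e : {x : Pt // x ∈ P} × {x : Pt // x ∈ P}, T.Adj e.1 e.2 ∧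
      ∀ u v, T.Adj u v → (Lf P e.1 e.2).card ≤ (Lf P u v).card := by
    obtain ⟨u0⟩ := hT.connected.nonempty
    obtain ⟨v0, h0⟩ := hT.connected.preconnected.exists_adj_of_nontrivial u0
    obtain ⟨e, he, hm⟩ := Finset.exists_min_image
      (Finset.univ.filter (fun e : {x : Pt // x ∈ P} × {x : Pt // x ∈ P} => T.Adj e.1 e.2))
      (fun e => (Lf P e.1 e.2).card) ⟨(u0, v0), by simpa using h0⟩
    refine ⟨e, by simpa using he, fun u v huv => hm (u, v) (by simpa using huv)⟩
  simp only at hij hmin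
  obtain ⟨i, hi⟩ := i
  obtain ⟨j, hj⟩ := j
  simp only at hmin
  have hijne : i ≠ j := fun h => hij.ne (Subtype.ext h)
  have hne : (Lf P i j).Nonempty := by
    by_contra hem
    apply hB
    refine ⟨_, _, hij, boundary_of_neg hijne ?_⟩
    intro x hx hxi hxj
    refine pos_or hgp hi hj hx hijne hxi hxj fun hpos => hem ⟨x, mem_Lf.2 ⟨hx, hpos⟩⟩
  obtain ⟨q, hqL, hqmin⟩ := Finset.exists_min_image (Lf P i j) (fun q => (Lf P i q).card) hne
  obtain ⟨hq, hqpos⟩ := mem_Lf.1 hqL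
  have hiq : i ≠ q := by rintro rfl; simp [Dt] at hqpos
  have hjq : j ≠ q := by rintro rfl; simp [Dt_same] at hqpos
  have hneg : ∀ x ∈ P, x ≠ i → x ≠ q → Dt i q x < 0 := by
    intro x hx hxi hxq
    refine pos_or hgp hi hq hx hiq hxi hxq fun hpos => ?_
    have hxj : x ≠ j := by
      rintro rfl
      rw [Dt_swap] at hpos; linarith
    by_cases hxp : 0 < Dt i j x
    · refine absurd (hqmin x (mem_Lf.2 ⟨hx, hxp⟩)) (not_le.2 (Finset.card_lt_card ?_))
      rw [Finset.ssubset_iff_of_subset]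
      · exact ⟨x, mem_Lf.2 ⟨hx, hpos⟩, fun h => by
          have := (mem_Lf.1 h).2
          simp [Dt_same] at this⟩
      · intro y hy
        obtain ⟨hyP, hy⟩ := mem_Lf.1 hy
        refine mem_Lf.2 ⟨hyP, ?_⟩
        by_contra hcon
        have hyi : y ≠ i := by rintro rfl; simp [Dt] at hy
        have hyq : y ≠ q := by
          rintro rfl
          rw [Dt_swap] at hy; linarith
        have := pos_or hgp hi hq hyP hiq hyi hyq hcon
        exact no_inside hcv hi hq hx hyP hpos hy (by rw [Dt_swap]; linarith)
    · have := pos_or hgp hi hj hx hijne hxi hxj hxp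
      exact no_inside hcv hi hj hq hx hqpos hpos (by rw [Dt_swap]; linarith)
  have hbd : BoundaryEdge (↑P : Set Pt) i q := boundary_of_neg hiq hneg
  obtain ⟨⟨b, hb⟩, hqb, T', hes, hT'⟩ := exchange T hT hij (q := ⟨q, hq⟩)
    (fun h => hiq (congrArg Subtype.val h).symm) (fun h => hjq (congrArg Subtype.val h).symm)
  have hqbne : b ≠ q := fun h => hqb.ne (Subtype.ext h.symm)
  have hbi : b ≠ i := by
    rintro rfl
    exact hB ⟨_, _, hqb.symm, hbd⟩
  have hiqb := hneg b hb hbi hqbne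
  have hqbi : Dt q b i < 0 := by rw [Dt_rot]; exact hiqb
  -- no edge lies within the left side of `i j`
  have nosub : ¬ Lf P q b ⊆ Lf P i j := by
    intro hsub
    refine absurd (hmin _ _ hqb) (not_le.2 (Finset.card_lt_card ?_))
    rw [Finset.ssubset_iff_of_subset hsub]
    exact ⟨q, hqL, fun h => by
      have := (mem_Lf.1 h).2
      simp [Dt] at this⟩
  have hbj : b ≠ j := by
    rintro rfl
    apply nosub
    intro x hx
    obtain ⟨hxP, hx⟩ := mem_Lf.1 hx
    refine mem_Lf.2 ⟨hxP, ?_⟩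
    by_contra hcon
    have hxi : x ≠ i := by rintro rfl; linarith
    have hxb : x ≠ b := by rintro rfl; simp [Dt_same] at hx
    have hn := pos_or hgp hi hb hxP hijne hxi hxb hcon
    refine no_inside hcv hb hxP hq hi ?_ ?_ ?_
    · rw [Dt_rot]; exact hx
    · rw [Dt_rot]; exact hqpos
    · rw [Dt_swap, Dt_rot]; linarith
  have hbneg : Dt i j b < 0 := by
    refine pos_or hgp hi hj hb hijne hbi hbj fun hpos => nosub ?_
    intro x hx
    obtain ⟨hxP, hx⟩ := mem_Lf.1 hx
    refine mem_Lf.2 ⟨hxP, ?_⟩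
    by_contra hcon
    have hxi : x ≠ i := by rintro rfl; linarith
    have hxb : x ≠ b := by rintro rfl; simp [Dt_same] at hx
    have hibq : 0 < Dt i b q := by rw [Dt_swap]; linarith
    have hixb : 0 < Dt i x b := by
      by_cases hxj : x = j
      · subst hxj; exact hpos
      have hn := pos_or hgp hi hj hxP hijne hxi hxj hcon
      by_contra hc
      have hn2 := pos_or hgp hi hxP hb hxi.symm hbi hxb.symm hc
      refine no_inside hcv hi hb hxP hj ?_ ?_ hpos
      · rw [Dt_swap]; linarith
      · rw [Dt_swap]; linarith
    refine no_inside hcv hb hq hi hxP ?_ ?_ ?_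
    · rw [Dt_rot]; exact hibq
    · have := Dt_rot b i x; have := Dt_rot i x b; linarith
    · have := Dt_rot b x q; have := Dt_rot q b x; linarith
  have hqbj : 0 < Dt q b j := by
    by_contra hc
    have hn := pos_or hgp hq hb hj hqbne.symm hjq hbj.symm hc
    refine no_inside hcv hj hb hq hi ?_ ?_ ?_
    · have := Dt_rot j q b; have := Dt_swap j q b; linarith
    · have := Dt_rot i j q; linarith
    · have := Dt_rot i j b; have := Dt_swap j b i; linarith
  have hcross := cross_of_Dt hqpos hbneg hqbi hqbj
  refine ⟨1, fun k => if k = 0 then T else T', by norm_num, by simp, ?_, ?_⟩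
  · intro k hk
    obtain rfl : k = 0 := by omega
    refine ⟨⟨i, hi⟩, ⟨j, hj⟩, ⟨q, hq⟩, ⟨b, hb⟩, hij, hqb, hcross, s(⟨i, hi⟩, ⟨q, hq⟩),
      s(⟨j, hj⟩, ⟨q, hq⟩), by simp, by simp, ?_, by simpa using hes, by simpa using hT'⟩
    intro he
    rcases Sym2.eq_iff.1 he with ⟨h1, _⟩ | ⟨h1, _⟩
    · exact hijne (congrArg Subtype.val h1)
    · exact hiq (congrArg Subtype.val h1)
  · refine ⟨⟨i, hi⟩, ⟨q, hq⟩, ?_, hbd⟩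
    simp only [one_ne_zero, if_false]
    rw [← SimpleGraph.mem_edgeSet, hes]
    right; left; rfl
end
end

section
/- There exists a constant c > 0 such that for every integer n ≥ 2 and every geometric spanning tree T on a set of n points in the plane in convex position (and in general position), T can be transformed into a plane spanning tree by at most c·n·log n flips; that is, f(T) = O(n log n). -/
open EuclideanGeometry Real

noncomputable section

/-- Orientation determinant. -/
def ori (a b c : Pt) : ℝ := (b 0 - a 0) * (c 1 - a 1) - (b 1 - a 1) * (c 0 - a 0)

lemma ori_no_cross {a b c d : Pt} (h : 0 < ori a b c * ori a b d) :
    ¬ (openSegment ℝ a b ∩ openSegment ℝ c d).Nonempty := by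
  rintro ⟨x, ⟨s, t, hs, ht, hst, rfl⟩, ⟨u, v, hu, hv, huv, h2⟩⟩
  have e0 := congrArg (fun z : Pt => z 0) h2
  have e1 := congrArg (fun z : Pt => z 1) h2
  simp at e0 e1
  have hs' : s = 1 - t := by linarith
  have hu' : u = 1 - v := by linarith
  have key : u * ori a b c + v * ori a b d = 0 := by
    have : u * ori a b c + v * ori a b d
        = (b 0 - a 0) * ((u * c 1 + v * d 1) - a 1) - (b 1 - a 1) * ((u * c 0 + v * d 0) - a 0) := by
      unfold ori; subst hu'; ring
    rw [this, e0, e1]; subst hs'; ring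
  rcases pos_and_pos_or_neg_and_neg_of_mul_pos h with ⟨h1, h2⟩ | ⟨h1, h2⟩
  · have := mul_pos hu h1; have := mul_pos hv h2; linarith
  · have := mul_neg_of_pos_of_neg hu h1; have := mul_neg_of_pos_of_neg hv h2; linarith

lemma ori_cross {a b c d : Pt} (h1 : 0 < ori a c b) (h2 : 0 < ori a c d)
    (h3 : 0 < ori a b d) (h4 : 0 < ori c b d) :
    (openSegment ℝ a b ∩ openSegment ℝ c d).Nonempty := by
  have hW : ori a c d + ori c b d = ori a c b + ori a b d := by unfold ori; ring
  have hW0 : 0 < ori a c d + ori c b d := by linarith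
  set W := ori a c d + ori c b d with hWd
  refine ⟨(ori c b d / W) • a + (ori a c d / W) • b,
    ⟨_, _, div_pos h4 hW0, div_pos h2 hW0, by field_simp; linarith, rfl⟩,
    ⟨ori a b d / W, ori a c b / W, div_pos h3 hW0, div_pos h1 hW0,
      by field_simp; linarith, ?_⟩⟩
  ext i
  fin_cases i
  · simp
    field_simp
    unfold ori; ring
  · simp
    field_simp
    unfold ori; ring

lemma ori_collinear {a b c : Pt} (h : ori a b c = 0) (hab : a ≠ b) :
    Collinear ℝ ({a, b, c} : Set Pt) := by
  rw [collinear_iff_of_mem (p₀ := a) (by simp)]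
  refine ⟨b - a, ?_⟩
  have hne : b 0 - a 0 ≠ 0 ∨ b 1 - a 1 ≠ 0 := by
    by_contra hh
    push Not at hh
    apply hab
    ext i
    fin_cases i
    · simpa using (sub_eq_zero.1 hh.1).symm
    · simpa using (sub_eq_zero.1 hh.2).symm
  unfold ori at h
  intro x hx
  simp only [Set.mem_insert_iff, Set.mem_singleton_iff] at hx
  rcases hx with rfl | rfl | rfl
  · exact ⟨0, by simp⟩
  · exact ⟨1, by simp⟩
  · rcases hne with h0 | h0
    · refine ⟨(x 0 - a 0) / (b 0 - a 0), ?_⟩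
      ext i
      fin_cases i
      · simp; field_simp; ring
      · simp; field_simp; linarith
    · refine ⟨(x 1 - a 1) / (b 1 - a 1), ?_⟩
      ext i
      fin_cases i
      · simp; field_simp; linarith
      · simp; field_simp; ring

lemma ori_inside {p a b c : Pt} (h1 : 0 < ori p a b) (h2 : 0 < ori p b c)
    (h3 : 0 < ori p a c) (h4 : ori a b c ≤ 0) {S : Set Pt} (hp : p ∈ S) (ha : a ∈ S)
    (hc : c ∈ S) : b ∈ convexHull ℝ S := by
  have hs : -ori a b c + ori p b c + ori p a b = ori p a c := by unfold ori; ring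
  have hb : b = (-ori a b c / ori p a c) • p + (ori p b c / ori p a c) • a
      + (ori p a b / ori p a c) • c := by
    have h3' := h3.ne'
    ext i
    fin_cases i
    · simp
      field_simp
      unfold ori; ring
    · simp
      field_simp
      unfold ori; ring
  rw [hb]
  have hconv := convex_convexHull ℝ S
  have h := hconv.sum_mem (t := (Finset.univ : Finset (Fin 3)))
    (w := ![-ori a b c / ori p a c, ori p b c / ori p a c, ori p a b / ori p a c])
    (z := ![p, a, c]) (by
      intro i _
      fin_cases i
      · exact div_nonneg (by linarith) h3.le
      · exact div_nonneg h2.le h3.le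
      · exact div_nonneg h1.le h3.le) (by
      rw [Fin.sum_univ_three]
      simp only [Matrix.cons_val_zero, Matrix.cons_val_one, Matrix.cons_val]
      rw [← add_div, ← add_div, hs, div_self h3.ne']) (by
      intro i _
      fin_cases i
      · exact subset_convexHull ℝ S hp
      · exact subset_convexHull ℝ S ha
      · exact subset_convexHull ℝ S hc)
  rw [Fin.sum_univ_three] at h
  exact h

/-- A real key sorting a convex point set counterclockwise. -/
lemma exists_key (P : Finset Pt) (hg : GenPos ↑P) (hc : ConvexPos ↑P) :
    ∃ key : {x : Pt // x ∈ P} → ℝ, Function.Injective key ∧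
      ∀ a b c, key a < key b → key b < key c → 0 < ori a.1 b.1 c.1 := by
  rcases P.eq_empty_or_nonempty with rfl | ⟨p, hp⟩
  · exact ⟨fun _ => 0, fun a => absurd a.2 (Finset.notMem_empty _),
      fun a => absurd a.2 (Finset.notMem_empty _)⟩
  have hfin : ((P : Set Pt) \ {p}).Finite := P.finite_toSet.subset Set.sdiff_subset
  obtain ⟨f, u, hfu, hf⟩ := geometric_hahn_banach_point_closed
    (convex_convexHull ℝ ((P : Set Pt) \ {p})) (hfin.isClosed_convexHull ℝ) (hc p hp)
  have hfe : ∀ v : Pt, f v = v 0 * f (EuclideanSpace.single 0 1)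
      + v 1 * f (EuclideanSpace.single 1 1) := by
    intro v
    have : v = v 0 • EuclideanSpace.single 0 1 + v 1 • EuclideanSpace.single 1 1 := by
      ext i
      fin_cases i <;> simp
    conv_lhs => rw [this]
    simp
  set α := f (EuclideanSpace.single 0 1)
  set β := f (EuclideanSpace.single 1 1)
  have hpos : ∀ q ∈ P, q ≠ p → 0 < (q 0 - p 0) * α + (q 1 - p 1) * β := by
    intro q hq hqp
    have h1 := hf q (subset_convexHull ℝ _ ⟨hq, hqp⟩)
    rw [hfe] at h1 hfu
    linarith
  let F : Pt → ℝ := fun q => (q 0 - p 0) * α + (q 1 - p 1) * β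
  let G : Pt → ℝ := fun q => (q 1 - p 1) * α - (q 0 - p 0) * β
  have hFG : ∀ q r, F q * G r - G q * F r = (α ^ 2 + β ^ 2) * ori p q r := by
    intro q r; simp only [F, G, ori]; ring
  have hab : 0 ≤ α ^ 2 + β ^ 2 := by positivity
  have hlt : ∀ q ∈ P, ∀ r ∈ P, q ≠ p → r ≠ p → G q / F q < G r / F r → 0 < ori p q r := by
    intro q hq r hr hqp hrp h
    rw [div_lt_div_iff₀ (hpos q hq hqp) (hpos r hr hrp)] at h
    have := hFG q r
    by_contra hh
    push Not at hh
    nlinarith [mul_nonneg hab (neg_nonneg.2 hh)]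
  have hab0 : ∀ q, q ∈ P → q ≠ p → 0 < α ^ 2 + β ^ 2 := by
    intro q hq hqp
    have := hpos _ hq hqp
    by_contra hh
    have h1 : α = 0 := by nlinarith [sq_nonneg α, sq_nonneg β]
    have h2 : β = 0 := by nlinarith [sq_nonneg α, sq_nonneg β]
    rw [h1, h2] at this; simp at this
  obtain ⟨M, hM⟩ := (Set.finite_range (fun a : {x : Pt // x ∈ P} => G a.1 / F a.1)).bddBelow
  have hM' : ∀ q ∈ P, M - 1 < G q / F q := by
    intro q hq
    have := hM ⟨⟨q, hq⟩, rfl⟩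
    simp only at this
    linarith
  classical
  let k : {x : Pt // x ∈ P} → ℝ := fun a => if a.1 = p then M - 1 else G a.1 / F a.1
  have kp : ∀ a, a.1 = p → k a = M - 1 := fun a h => if_pos h
  have kn : ∀ a, a.1 ≠ p → k a = G a.1 / F a.1 := fun a h => if_neg h
  have kmin : ∀ a, M - 1 ≤ k a := by
    intro a
    by_cases h : a.1 = p
    · rw [kp a h]
    · rw [kn a h]; exact (hM' _ a.2).le
  refine ⟨k, ?_, ?_⟩
  · intro a b hk
    by_contra hne
    have hne' : a.1 ≠ b.1 := fun h => hne (Subtype.ext h)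
    by_cases ha : a.1 = p
    · have hb : b.1 ≠ p := fun h => hne' (ha.trans h.symm)
      rw [kp a ha, kn b hb] at hk
      exact (hM' _ b.2).ne hk
    · by_cases hb : b.1 = p
      · rw [kp b hb, kn a ha] at hk
        exact (hM' _ a.2).ne hk.symm
      · rw [kn a ha, kn b hb, div_eq_div_iff (hpos _ a.2 ha).ne' (hpos _ b.2 hb).ne'] at hk
        have h1 := hFG a.1 b.1
        have h2 : (α ^ 2 + β ^ 2) * ori p a.1 b.1 = 0 := by rw [← h1]; linarith
        have h3 := (mul_eq_zero.1 h2).resolve_left (hab0 _ a.2 ha).ne'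
        exact hg p hp a.1 a.2 b.1 b.2 (Ne.symm ha) (Ne.symm hb) hne'
          (ori_collinear h3 (Ne.symm ha))
  · intro a b c h1 h2
    have hb : b.1 ≠ p := by
      intro h; rw [kp b h] at h1; linarith [kmin a]
    have hc' : c.1 ≠ p := by
      intro h; rw [kp c h] at h2; linarith [kmin b]
    by_cases ha : a.1 = p
    · rw [kn b hb, kn c hc'] at h2
      rw [ha]
      exact hlt _ b.2 _ c.2 hb hc' h2
    · rw [kn a ha, kn b hb] at h1
      rw [kn b hb, kn c hc'] at h2
      by_contra hh
      push Not at hh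
      refine hc b.1 b.2 (ori_inside (hlt _ a.2 _ b.2 ha hb h1) (hlt _ b.2 _ c.2 hb hc' h2)
        (hlt _ a.2 _ c.2 ha hc' (h1.trans h2)) hh ⟨hp, Ne.symm hb⟩ ⟨a.2, ?_⟩ ⟨c.2, ?_⟩)
      · intro h
        rw [Set.mem_singleton_iff.1 h] at h1
        exact lt_irrefl _ h1
      · intro h
        rw [Set.mem_singleton_iff.1 h] at h2
        exact lt_irrefl _ h2

lemma ori_swap (a b c : Pt) : ori a c b = -ori a b c := by unfold ori; ring

lemma segCross_swap {a b c d : Pt} (h : SegCross a b c d) : SegCross b a c d := by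
  obtain ⟨h1, h2, h3, h4, h5, h6, h7⟩ := h
  exact ⟨h1.symm, h4, h5, h2, h3, h6, by rwa [openSegment_symm]⟩

lemma segCross_comm {a b c d : Pt} (h : SegCross a b c d) : SegCross c d a b := by
  obtain ⟨h1, h2, h3, h4, h5, h6, h7⟩ := h
  exact ⟨h6, h2.symm, h4.symm, h3.symm, h5.symm, h1, by rwa [Set.inter_comm]⟩

/-- Crossing is interleaving of keys. -/
lemma segCross_iff {V : Type} [LinearOrder V] (pos : V → Pt) (hinj : Function.Injective pos)
    (ho : ∀ a b c : V, a < b → b < c → 0 < ori (pos a) (pos b) (pos c))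
    (a b c d : V) (hab : a < b) (hcd : c < d) :
    SegCross (pos a) (pos b) (pos c) (pos d) ↔
      (a < c ∧ c < b ∧ b < d) ∨ (c < a ∧ a < d ∧ d < b) := by
  have fwd : ∀ a b c d : V, a < c → c < b → b < d →
      SegCross (pos a) (pos b) (pos c) (pos d) := by
    intro a b c d h1 h2 h3
    exact ⟨hinj.ne (h1.trans h2).ne, hinj.ne h1.ne, hinj.ne (h1.trans (h2.trans h3)).ne,
      hinj.ne h2.ne', hinj.ne h3.ne, hinj.ne (h2.trans h3).ne,
      ori_cross (ho _ _ _ h1 h2) (ho _ _ _ h1 (h2.trans h3)) (ho _ _ _ (h1.trans h2) h3)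
        (ho _ _ _ h2 h3)⟩
  constructor
  · rintro ⟨n1, n2, n3, n4, n5, n6, hx⟩
    have m2 : a ≠ c := fun h => n2 (congrArg pos h)
    have m3 : a ≠ d := fun h => n3 (congrArg pos h)
    have m4 : b ≠ c := fun h => n4 (congrArg pos h)
    have m5 : b ≠ d := fun h => n5 (congrArg pos h)
    by_contra hno
    have hx' : (openSegment ℝ (pos c) (pos d) ∩ openSegment ℝ (pos a) (pos b)).Nonempty := by
      rwa [Set.inter_comm]
    have cases4 : (b < c) ∨ (d < a) ∨ (a < c ∧ d < b) ∨ (c < a ∧ b < d) := by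
      grind
    rcases cases4 with h | h | ⟨h, h'⟩ | ⟨h, h'⟩
    · exact ori_no_cross (mul_pos (ho _ _ _ hab h) (ho _ _ _ hab (h.trans hcd))) hx
    · exact ori_no_cross (mul_pos (ho _ _ _ hcd h) (ho _ _ _ hcd (h.trans hab))) hx'
    · refine ori_no_cross ?_ hx
      have h1 := ho _ _ _ h (hcd.trans h')
      have h2 := ho _ _ _ (h.trans hcd) h'
      rw [ori_swap (pos a) (pos c) (pos b), ori_swap (pos a) (pos d) (pos b), neg_mul_neg]
      exact mul_pos h1 h2
    · refine ori_no_cross ?_ hx'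
      have h1 := ho _ _ _ h (hab.trans h')
      have h2 := ho _ _ _ (h.trans hab) h'
      rw [ori_swap (pos c) (pos a) (pos d), ori_swap (pos c) (pos b) (pos d), neg_mul_neg]
      exact mul_pos h1 h2
  · rintro (⟨h1, h2, h3⟩ | ⟨h1, h2, h3⟩)
    · exact fwd _ _ _ _ h1 h2 h3
    · exact segCross_comm (fwd _ _ _ _ h1 h2 h3)

section Comb

open Classical

set_option linter.unusedSectionVars false

variable {V : Type} [Fintype V] [LinearOrder V]

/-- Crossing is interleaving. -/
def Interl (pos : V → Pt) : Prop :=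
  ∀ a b c d : V, a < b → c < d → (SegCross (pos a) (pos b) (pos c) (pos d) ↔
      (a < c ∧ c < b ∧ b < d) ∨ (c < a ∧ a < d ∧ d < b))

/-- `ab` is an edge of `T` crossed by another edge. -/
def CrE (pos : V → Pt) (T : SimpleGraph V) (a b : V) : Prop :=
  T.Adj a b ∧ ∃ c d, T.Adj c d ∧ SegCross (pos a) (pos b) (pos c) (pos d)

/-- Active vertices. -/
def Act (pos : V → Pt) (T : SimpleGraph V) (v : V) : Prop := ∃ w, CrE pos T v w

/-- Depth: number of active vertices in `[a,b)`. -/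
def dep (pos : V → Pt) (T : SimpleGraph V) (a b : V) : ℕ :=
  (Finset.univ.filter (fun v => Act pos T v ∧ a ≤ v ∧ v < b)).card

/-- The crossed edges. -/
def CS (pos : V → Pt) (T : SimpleGraph V) : Finset (V × V) :=
  Finset.univ.filter (fun e => e.1 < e.2 ∧ CrE pos T e.1 e.2)

/-- The potential. -/
def Pot (pos : V → Pt) (T : SimpleGraph V) : ℝ :=
  ∑ e ∈ CS pos T, Real.log (dep pos T e.1 e.2)

lemma CrE.symm {pos : V → Pt} {T : SimpleGraph V} {a b : V} (h : CrE pos T a b) :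
    CrE pos T b a := by
  obtain ⟨h1, c, d, h2, h3⟩ := h
  exact ⟨h1.symm, c, d, h2, segCross_swap h3⟩

lemma CrE.other {pos : V → Pt} {T : SimpleGraph V} {a b c d : V} (h1 : T.Adj a b)
    (h2 : T.Adj c d) (h : SegCross (pos a) (pos b) (pos c) (pos d)) :
    CrE pos T a b ∧ CrE pos T c d :=
  ⟨⟨h1, c, d, h2, h⟩, ⟨h2, a, b, h1, segCross_comm h⟩⟩

lemma dep_add (pos : V → Pt) (T : SimpleGraph V) {a b c : V} (h1 : a ≤ b) (h2 : b ≤ c) :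
    dep pos T a c = dep pos T a b + dep pos T b c := by
  unfold dep
  rw [← Finset.card_union_of_disjoint]
  · congr 1
    ext v
    simp only [Finset.mem_filter, Finset.mem_univ, true_and, Finset.mem_union]
    grind
  · rw [Finset.disjoint_left]
    intro v
    simp only [Finset.mem_filter, Finset.mem_univ, true_and]
    grind

lemma dep_pos (pos : V → Pt) (T : SimpleGraph V) {a b : V} (h1 : a < b) (h2 : Act pos T a) :
    1 ≤ dep pos T a b :=
  Finset.card_pos.2 ⟨a, by simp [h1, h2]⟩

lemma dep_mono (pos : V → Pt) (T T' : SimpleGraph V)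
    (h : ∀ v, Act pos T' v → Act pos T v) (a b : V) : dep pos T' a b ≤ dep pos T a b := by
  unfold dep
  apply Finset.card_le_card
  intro v
  simp only [Finset.mem_filter, Finset.mem_univ, true_and]
  exact fun hv => ⟨h v hv.1, hv.2⟩

lemma logNat_mono {m n : ℕ} (h : m ≤ n) : Real.log m ≤ Real.log n := by
  rcases Nat.eq_zero_or_pos m with rfl | hm
  · simpa using Real.log_natCast_nonneg n
  · exact Real.log_le_log (by exact_mod_cast hm) (by exact_mod_cast h)

lemma exists_rank (S : Finset V) : ∀ k < S.card, ∃ c ∈ S, (S.filter (· < c)).card = k := by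
  induction S using Finset.induction_on_max with
  | empty => intro k hk; simp at hk
  | insert a s ha ih =>
    intro k hk
    have hns : a ∉ s := fun h => lt_irrefl _ (ha a h)
    rw [Finset.card_insert_of_notMem hns] at hk
    rcases Nat.lt_succ_iff_lt_or_eq.1 hk with h | h
    · obtain ⟨c, hc, hk'⟩ := ih k h
      refine ⟨c, Finset.mem_insert_of_mem hc, ?_⟩
      rw [Finset.filter_insert, if_neg (not_lt.2 (ha c hc).le), hk']
    · refine ⟨a, Finset.mem_insert_self _ _, ?_⟩
      rw [Finset.filter_insert, if_neg (lt_irrefl a), Finset.filter_true_of_mem ha, h]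

/-- The new edges cross nothing new. -/
lemma cross_transfer {pos : V → Pt} (hX : Interl pos) {p q r s u v x y : V}
    (hpq : p < q) (hqr : q < r) (hrs : r < s)
    (huv : (u = p ∧ v = q) ∨ (u = r ∧ v = s) ∨ (u = p ∧ v = s) ∨ (u = q ∧ v = r))
    (hxy : x ≠ y) (h : SegCross (pos x) (pos y) (pos u) (pos v)) :
    SegCross (pos x) (pos y) (pos p) (pos r) ∨ SegCross (pos x) (pos y) (pos q) (pos s) := by
  have key : ∀ x y, x < y → SegCross (pos x) (pos y) (pos u) (pos v) →
    SegCross (pos x) (pos y) (pos p) (pos r) ∨ SegCross (pos x) (pos y) (pos q) (pos s) := by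
    intro x y hxy h
    have huv' : u < v := by grind
    rw [hX _ _ _ _ hxy huv'] at h
    rw [hX _ _ _ _ hxy (hpq.trans hqr), hX _ _ _ _ hxy (hqr.trans hrs)]
    rcases huv with ⟨rfl, rfl⟩ | ⟨rfl, rfl⟩ | ⟨rfl, rfl⟩ | ⟨rfl, rfl⟩ <;> grind
  rcases lt_or_gt_of_ne hxy with h' | h'
  · exact key x y h' h
  · exact (key y x h' (segCross_swap h)).imp segCross_swap segCross_swap

lemma all_of_closed {T : SimpleGraph V} (hT : T.Connected) (S : V → Prop) {p : V} (hp : S p)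
    (hS : ∀ a b, T.Adj a b → S a → S b) (v : V) : S v := by
  obtain ⟨w⟩ := hT.preconnected p v
  induction w with
  | nil => exact hp
  | cons h _ ih => exact ih (hS _ _ h hp)

/-- Adjacency after exchanging `pr, qs` for `e₁, e₂`. -/
def exch (T : SimpleGraph V) (p q r s : V) (e₁ e₂ : Sym2 V) : SimpleGraph V :=
  SimpleGraph.fromEdgeSet ((T.edgeSet \ {s(p, r), s(q, s)}) ∪ {e₁, e₂})

lemma exch_edgeSet (T : SimpleGraph V) (p q r s : V) (e₁ e₂ : Sym2 V)
    (h₁ : ¬ e₁.IsDiag) (h₂ : ¬ e₂.IsDiag) :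
    (exch T p q r s e₁ e₂).edgeSet = (T.edgeSet \ {s(p, r), s(q, s)}) ∪ {e₁, e₂} := by
  unfold exch
  rw [SimpleGraph.edgeSet_fromEdgeSet]
  ext e
  have := fun h : e ∈ T.edgeSet => T.not_isDiag_of_mem_edgeSet h
  simp only [Set.mem_sdiff, Set.mem_union, Set.mem_insert_iff, Set.mem_singleton_iff]
  constructor
  · exact fun h => h.1
  · intro h
    refine ⟨h, ?_⟩
    rcases h with h | rfl | rfl
    · exact this h.1
    · exact h₁
    · exact h₂

lemma exch_isTree {T : SimpleGraph V} (hT : T.IsTree) {p q r s : V} {e₁ e₂ : Sym2 V}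
    (hpr : T.Adj p r) (hqs : T.Adj q s) (hne : s(p, r) ≠ s(q, s))
    (h₁ : ¬ e₁.IsDiag) (h₂ : ¬ e₂.IsDiag)
    (hq : (exch T p q r s e₁ e₂).Reachable p q) (hr : (exch T p q r s e₁ e₂).Reachable p r)
    (hs : (exch T p q r s e₁ e₂).Reachable p s) : (exch T p q r s e₁ e₂).IsTree := by
  have hedge := exch_edgeSet T p q r s e₁ e₂ h₁ h₂
  set T' := exch T p q r s e₁ e₂ with hT'
  have hall : ∀ v, T'.Reachable p v := by
    refine all_of_closed hT.connected (fun v => T'.Reachable p v) (p := p) (by rfl) ?_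
    intro a b hab ha
    by_cases h : s(a, b) ∈ T'.edgeSet
    · exact ha.trans (SimpleGraph.Adj.reachable h)
    · have : s(a, b) = s(p, r) ∨ s(a, b) = s(q, s) := by
        by_contra hh
        apply h
        rw [hedge]
        exact Or.inl ⟨hab, hh⟩
      rcases this with h | h <;> rw [Sym2.eq_iff] at h <;>
        rcases h with ⟨rfl, rfl⟩ | ⟨rfl, rfl⟩ <;> first | assumption | rfl
  have : Nonempty V := ⟨p⟩
  have hconn : T'.Connected :=
    ⟨fun a b => (hall a).symm.trans (hall b)⟩
  rw [SimpleGraph.isTree_iff_connected_and_card]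
  refine ⟨hconn, le_antisymm ?_ ?_⟩
  · have h1 := (SimpleGraph.isTree_iff_connected_and_card.1 hT).2
    rw [← h1]
    rw [Nat.card_coe_set_eq, Nat.card_coe_set_eq, hedge]
    have h2 : ({s(p, r), s(q, s)} : Set (Sym2 V)) ⊆ T.edgeSet := by
      rintro e (rfl | rfl)
      · exact hpr
      · exact hqs
    have h3 := Set.ncard_sdiff_add_ncard_of_subset h2
    have h4 := Set.ncard_pair hne
    have h5 := Set.ncard_union_le (T.edgeSet \ {s(p, r), s(q, s)}) {e₁, e₂}
    have h6 : ({e₁, e₂} : Set (Sym2 V)).ncard ≤ 2 := by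
      refine (Set.ncard_insert_le _ _).trans ?_
      simp
    omega
  · exact hconn.card_vert_le_card_edgeSet_add_one

/-- One of the two degree preserving exchanges gives a tree. -/
lemma exists_exch {T : SimpleGraph V} (hT : T.IsTree) {p q r s : V}
    (hpr : T.Adj p r) (hqs : T.Adj q s) (hpq : p < q) (hqr : q < r) (hrs : r < s) :
    (exch T p q r s s(p, q) s(r, s)).IsTree ∨ (exch T p q r s s(p, s) s(q, r)).IsTree := by
  have hne : s(p, r) ≠ s(q, s) := by
    intro h; rw [Sym2.eq_iff] at h; grind
  have d1 : ¬ s(p, q).IsDiag := by simpa using hpq.ne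
  have d2 : ¬ s(r, s).IsDiag := by simpa using hrs.ne
  have d3 : ¬ s(p, s).IsDiag := by simpa using (hpq.trans (hqr.trans hrs)).ne
  have d4 : ¬ s(q, r).IsDiag := by simpa using hqr.ne
  let H := T.deleteEdges {s(p, r), s(q, s)}
  have hHle : ∀ e₁ e₂, ¬ e₁.IsDiag → ¬ e₂.IsDiag → H ≤ exch T p q r s e₁ e₂ := by
    intro e₁ e₂ h₁ h₂
    rw [← SimpleGraph.edgeSet_subset_edgeSet, exch_edgeSet _ _ _ _ _ _ _ h₁ h₂,
      SimpleGraph.edgeSet_deleteEdges]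
    exact Set.subset_union_left
  have hadj : ∀ e₁ e₂, ¬ e₁.IsDiag → ¬ e₂.IsDiag → ∀ a b, (s(a, b) = e₁ ∨ s(a, b) = e₂) →
      (exch T p q r s e₁ e₂).Reachable a b := by
    intro e₁ e₂ h₁ h₂ a b h
    apply SimpleGraph.Adj.reachable
    rw [← SimpleGraph.mem_edgeSet, exch_edgeSet _ _ _ _ _ _ _ h₁ h₂]
    exact Or.inr h
  have hlink : (H.Reachable p q ∨ H.Reachable r s) ∨ (H.Reachable p s ∨ H.Reachable r q) := by
    by_contra hno
    push Not at hno
    have := all_of_closed hT.connected (fun v => H.Reachable p v ∨ H.Reachable r v) (p := p)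
      (Or.inl (by rfl)) (by
        intro a b hab ha
        by_cases h : H.Adj a b
        · exact ha.imp (fun h' => h'.trans h.reachable) (fun h' => h'.trans h.reachable)
        · have : s(a, b) = s(p, r) ∨ s(a, b) = s(q, s) := by
            by_contra hh
            apply h
            rw [SimpleGraph.deleteEdges_adj]
            exact ⟨hab, hh⟩
          rcases this with h | h <;> rw [Sym2.eq_iff] at h <;>
            rcases h with ⟨rfl, rfl⟩ | ⟨rfl, rfl⟩
          · exact Or.inr (by rfl)
          · exact Or.inl (by rfl)
          · exact absurd ha (by tauto)
          · exact absurd ha (by tauto)) q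
    tauto
  rcases hlink with h | h
  · right
    have a1 := hadj s(p, s) s(q, r) d3 d4 p s (Or.inl rfl)
    have a2 := hadj s(p, s) s(q, r) d3 d4 q r (Or.inr rfl)
    have hle := hHle s(p, s) s(q, r) d3 d4
    rcases h with h | h
    · have h' := h.mono hle
      exact exch_isTree hT hpr hqs hne d3 d4 h' (h'.trans a2) a1
    · have h' := h.mono hle
      exact exch_isTree hT hpr hqs hne d3 d4 (a1.trans (h'.symm.trans a2.symm))
        (a1.trans h'.symm) a1
  · left
    have a1 := hadj s(p, q) s(r, s) d1 d2 p q (Or.inl rfl)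
    have a2 := hadj s(p, q) s(r, s) d1 d2 r s (Or.inr rfl)
    have hle := hHle s(p, q) s(r, s) d1 d2
    rcases h with h | h
    · have h' := h.mono hle
      exact exch_isTree hT hpr hqs hne d1 d2 a1 (h'.trans a2.symm) h'
    · have h' := h.mono hle
      exact exch_isTree hT hpr hqs hne d1 d2 a1 (a1.trans h'.symm)
        (a1.trans (h'.symm.trans a2))

/-- Effect of an exchange on the potential. -/
lemma pot_exch {pos : V → Pt} (hX : Interl pos) {T T' : SimpleGraph V} {p q r s u₁ v₁ u₂ v₂ : V}
    (hpq : p < q) (hqr : q < r) (hrs : r < s) (hpr : T.Adj p r) (hqs : T.Adj q s)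
    (h1 : (u₁ = p ∧ v₁ = q) ∨ (u₁ = r ∧ v₁ = s) ∨ (u₁ = p ∧ v₁ = s) ∨ (u₁ = q ∧ v₁ = r))
    (h2 : (u₂ = p ∧ v₂ = q) ∨ (u₂ = r ∧ v₂ = s) ∨ (u₂ = p ∧ v₂ = s) ∨ (u₂ = q ∧ v₂ = r))
    (hE : T'.edgeSet = (T.edgeSet \ {s(p, r), s(q, s)}) ∪ {s(u₁, v₁), s(u₂, v₂)}) :
    Pot pos T' + Real.log (dep pos T p r) + Real.log (dep pos T q s) ≤
      Pot pos T + Real.log (dep pos T u₁ v₁) + Real.log (dep pos T u₂ v₂) := by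
  have hadj : ∀ a b, T'.Adj a b → (T.Adj a b ∧ s(a, b) ≠ s(p, r) ∧ s(a, b) ≠ s(q, s)) ∨
      s(a, b) = s(u₁, v₁) ∨ s(a, b) = s(u₂, v₂) := by
    intro a b h
    rw [← SimpleGraph.mem_edgeSet, hE] at h
    rcases h with ⟨h, h'⟩ | h
    · refine Or.inl ⟨h, ?_, ?_⟩ <;> intro h'' <;> apply h' <;> simp [h'']
    · exact Or.inr h
  have hcr : SegCross (pos p) (pos r) (pos q) (pos s) :=
    (hX _ _ _ _ (hpq.trans hqr) (hqr.trans hrs)).2 (Or.inl ⟨hpq, hqr, hrs⟩)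
  obtain ⟨c1, c2⟩ := CrE.other hpr hqs hcr
  -- old edges crossed afterwards were crossed before
  have hold : ∀ a b, T.Adj a b → CrE pos T' a b → CrE pos T a b := by
    rintro a b hab ⟨-, c, d, hcd, hc⟩
    have tr : ∀ u v : V, ((u = p ∧ v = q) ∨ (u = r ∧ v = s) ∨ (u = p ∧ v = s) ∨ (u = q ∧ v = r)) →
        SegCross (pos a) (pos b) (pos u) (pos v) → CrE pos T a b := by
      intro u v huv h
      rcases cross_transfer hX hpq hqr hrs huv hab.ne h with h | h
      · exact ⟨hab, p, r, hpr, h⟩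
      · exact ⟨hab, q, s, hqs, h⟩
    have sw : SegCross (pos a) (pos b) (pos d) (pos c) :=
      segCross_comm (segCross_swap (segCross_comm hc))
    rcases hadj c d hcd with h | h | h
    · exact ⟨hab, c, d, h.1, hc⟩
    · rw [Sym2.eq_iff] at h
      rcases h with ⟨rfl, rfl⟩ | ⟨rfl, rfl⟩
      · exact tr _ _ h1 hc
      · exact tr _ _ h1 sw
    · rw [Sym2.eq_iff] at h
      rcases h with ⟨rfl, rfl⟩ | ⟨rfl, rfl⟩
      · exact tr _ _ h2 hc
      · exact tr _ _ h2 sw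
  have ap : Act pos T p := ⟨r, c1⟩
  have ar : Act pos T r := ⟨p, c1.symm⟩
  have aq : Act pos T q := ⟨s, c2⟩
  have as : Act pos T s := ⟨q, c2.symm⟩
  have hact : ∀ v, Act pos T' v → Act pos T v := by
    rintro v ⟨w, hw⟩
    rcases hadj v w hw.1 with h | h | h
    · exact ⟨w, hold v w h.1 hw⟩
    · rw [Sym2.eq_iff] at h; grind
    · rw [Sym2.eq_iff] at h; grind
  let L : V × V → ℝ := fun e => Real.log (dep pos T e.1 e.2)
  have hL : ∀ e, 0 ≤ L e := fun e => Real.log_natCast_nonneg _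
  have hsub : CS pos T' ⊆ insert (u₁, v₁) (insert (u₂, v₂) (((CS pos T).erase (p, r)).erase (q, s))) := by
    rintro ⟨a, b⟩ hab
    simp only [CS, Finset.mem_filter, Finset.mem_univ, true_and] at hab
    simp only [CS, Finset.mem_filter, Finset.mem_univ, true_and, Finset.mem_insert,
      Finset.mem_erase, Prod.mk.injEq, ne_eq]
    rcases hadj a b hab.2.1 with h | h | h
    · right; right
      refine ⟨?_, ?_, hab.1, hold a b h.1 hab.2⟩
      · rintro ⟨rfl, rfl⟩; exact h.2.2 rfl
      · rintro ⟨rfl, rfl⟩; exact h.2.1 rfl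
    · left
      rw [Sym2.eq_iff] at h
      have := hab.1
      grind
    · right; left
      rw [Sym2.eq_iff] at h
      have := hab.1
      grind
  have e1 : Pot pos T' ≤ ∑ e ∈ CS pos T', L e :=
    Finset.sum_le_sum fun e _ => logNat_mono (dep_mono pos T T' hact _ _)
  have e2 := Finset.sum_le_sum_of_subset_of_nonneg hsub (f := L) fun e _ _ => hL e
  have ins : ∀ (x : V × V) (S : Finset (V × V)), ∑ e ∈ insert x S, L e ≤ L x + ∑ e ∈ S, L e := by
    intro x S
    by_cases h : x ∈ S
    · rw [Finset.insert_eq_of_mem h]; linarith [hL x]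
    · rw [Finset.sum_insert h]
  have e3 := ins (u₁, v₁) (insert (u₂, v₂) (((CS pos T).erase (p, r)).erase (q, s)))
  have e4 := ins (u₂, v₂) (((CS pos T).erase (p, r)).erase (q, s))
  have m1 : (p, r) ∈ CS pos T := by simp [CS, c1, hpq.trans hqr]
  have m2 : (q, s) ∈ (CS pos T).erase (p, r) := by
    simp [CS, c2, hqr.trans hrs, hpq.ne']
  have e5 := Finset.add_sum_erase _ L m1
  have e6 := Finset.add_sum_erase _ L m2
  have e7 : Pot pos T = ∑ e ∈ CS pos T, L e := rfl
  have l1 : L (p, r) = Real.log (dep pos T p r) := rfl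
  have l2 : L (q, s) = Real.log (dep pos T q s) := rfl
  have l3 : L (u₁, v₁) = Real.log (dep pos T u₁ v₁) := rfl
  have l4 : L (u₂, v₂) = Real.log (dep pos T u₂ v₂) := rfl
  linarith

/-- A crossing with balanced depths. -/
lemma exists_good {pos : V → Pt} (hX : Interl pos) {T : SimpleGraph V}
    (hnp : ¬ TreePlane pos T) :
    ∃ p q r s : V, p < q ∧ q < r ∧ r < s ∧ T.Adj p r ∧ T.Adj q s ∧
      ((dep pos T p q ≤ 2 * dep pos T q r ∧ dep pos T q r ≤ 2 * dep pos T p q ∧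
        dep pos T p q ≤ dep pos T r s) ∨
       (dep pos T r s ≤ 2 * dep pos T q r ∧ dep pos T q r ≤ 2 * dep pos T r s ∧
        dep pos T r s ≤ dep pos T p q)) := by
  have hmem : ∀ a b, a < b → CrE pos T a b → (a, b) ∈ CS pos T := by
    intro a b h1 h2; simp [CS, h1, h2]
  have hne : (CS pos T).Nonempty := by
    unfold TreePlane at hnp
    push Not at hnp
    obtain ⟨a, b, c, d, h1, h2, h3⟩ := hnp
    have hc := (CrE.other h1 h2 h3).1
    rcases lt_or_gt_of_ne h1.ne with h | h
    · exact ⟨_, hmem a b h hc⟩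
    · exact ⟨_, hmem b a h hc.symm⟩
  obtain ⟨⟨a, b⟩, hab, hmin⟩ := Finset.exists_min_image _ (fun e => dep pos T e.1 e.2) hne
  have hmin' : ∀ x y, x < y → CrE pos T x y → dep pos T a b ≤ dep pos T x y :=
    fun x y h1 h2 => hmin (x, y) (hmem x y h1 h2)
  simp only [CS, Finset.mem_filter, Finset.mem_univ, true_and] at hab
  obtain ⟨hlt, hcr⟩ := hab
  have aa : Act pos T a := ⟨b, hcr⟩
  -- an active vertex strictly inside has its crossed edges going out
  have hout : ∀ c d, a < c → c < b → CrE pos T c d → d < a ∨ b < d := by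
    intro c d h1 h2 h
    by_contra hh
    push Not at hh
    have hcd := h.1.ne
    have hca : Act pos T c := ⟨d, h⟩
    rcases lt_or_gt_of_ne hcd with h' | h'
    · have k1 := hmin' c d h' h
      have k2 := dep_add pos T h1.le h2.le
      have k3 := dep_add pos T h'.le hh.2
      have k4 := dep_pos pos T h1 aa
      omega
    · have k1 := hmin' d c h' h.symm
      have k2 := dep_add pos T h1.le h2.le
      have k3 := dep_add pos T hh.1 h'.le
      have k4 := dep_pos pos T h2 hca
      omega
  -- there is an active vertex inside
  have hin : ∃ c, a < c ∧ c < b ∧ Act pos T c := by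
    obtain ⟨hA, c, d, hcd, hx⟩ := hcr
    have hc := (CrE.other hA hcd hx).2
    rcases lt_or_gt_of_ne hcd.ne with h | h
    · rcases (hX _ _ _ _ hlt h).1 hx with h' | h'
      · exact ⟨c, h'.1, h'.2.1, d, hc⟩
      · exact ⟨d, h'.2.1, h'.2.2, c, hc.symm⟩
    · rcases (hX _ _ _ _ hlt h).1 (segCross_comm (segCross_swap (segCross_comm hx))) with h' | h'
      · exact ⟨d, h'.1, h'.2.1, c, hc.symm⟩
      · exact ⟨c, h'.2.1, h'.2.2, d, hc⟩
  have hN : 2 ≤ dep pos T a b := by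
    obtain ⟨c, h1, h2, h3⟩ := hin
    have k2 := dep_add pos T h1.le h2.le
    have k3 := dep_pos pos T h1 aa
    have k4 := dep_pos pos T h2 h3
    omega
  obtain ⟨c, hcS, hck⟩ := exists_rank
    (Finset.univ.filter (fun v => Act pos T v ∧ a ≤ v ∧ v < b)) (dep pos T a b / 2) (by
      change dep pos T a b / 2 < dep pos T a b
      omega)
  simp only [Finset.mem_filter, Finset.mem_univ, true_and] at hcS
  obtain ⟨hca, hac, hcb⟩ := hcS
  have hck' : dep pos T a c = dep pos T a b / 2 := by
    rw [← hck]
    unfold dep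
    rw [Finset.filter_filter]
    congr 1
    ext v
    simp only [Finset.mem_filter, Finset.mem_univ, true_and]
    grind
  have hac' : a < c := by
    rcases hac.lt_or_eq with h | h
    · exact h
    · subst h
      have : dep pos T a a = 0 := by
        unfold dep
        rw [Finset.card_eq_zero, Finset.filter_eq_empty_iff]
        intro v _ hv
        exact absurd hv.2.1 (not_le.2 hv.2.2)
      omega
  have hsum := dep_add pos T hac hcb.le
  obtain ⟨d, hd⟩ := hca
  rcases hout c d hac' hcb hd with h | h
  · have k1 := hmin' d c (h.trans hac') hd.symm
    have k2 := dep_add pos T h.le hac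
    exact ⟨d, a, c, b, h, hac', hcb, hd.1.symm, hcr.1, Or.inr (by omega)⟩
  · have k1 := hmin' c d (hcb.trans h) hd
    have k2 := dep_add pos T hcb.le h.le
    exact ⟨a, c, b, d, hac', hcb, h, hcr.1, hd.1, Or.inl (by omega)⟩

lemma numeric {x y z : ℝ} (hx : 0 < x) (hy : 0 < y) (hz : 0 < z)
    (h : (x ≤ 2 * y ∧ y ≤ 2 * x ∧ x ≤ z) ∨ (z ≤ 2 * y ∧ y ≤ 2 * z ∧ z ≤ x)) :
    9 * (x * z) ≤ 8 * ((x + y) * (y + z)) ∧ 9 * ((x + y + z) * y) ≤ 8 * ((x + y) * (y + z)) := by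
  have key : ∀ x y z : ℝ, 0 < x → 0 < y → 0 < z → x ≤ 2 * y → y ≤ 2 * x → x ≤ z →
      9 * (x * z) ≤ 8 * ((x + y) * (y + z)) ∧
        9 * ((x + y + z) * y) ≤ 8 * ((x + y) * (y + z)) := by
    intro x y z hx hy hz h1 h2 h3
    constructor
    · nlinarith [mul_nonneg (sub_nonneg.2 h1) hz.le, mul_pos hx hy, mul_pos hy hz, mul_pos hy hy]
    · skip
      have a1 : x + y ≤ 3 * x := by linarith
      have a2 : y + z ≤ 3 * z := by linarith
      have a3 : (x + y) * (y + z) ≤ (3 * x) * (3 * z) :=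
        mul_le_mul a1 a2 (by positivity) (by positivity)
      nlinarith
  rcases h with ⟨h1, h2, h3⟩ | ⟨h1, h2, h3⟩
  · exact key x y z hx hy hz h1 h2 h3
  · obtain ⟨k1, k2⟩ := key z y x hz hy hx h1 h2 h3
    constructor <;> nlinarith

/-- Each non-plane tree admits a flip decreasing the potential by a constant. -/
lemma exists_flip {pos : V → Pt} (hX : Interl pos) {T : SimpleGraph V} (hT : T.IsTree)
    (hnp : ¬ TreePlane pos T) :
    ∃ T', TreeFlip pos T T' ∧ T'.IsTree ∧ Pot pos T' + Real.log (9 / 8) ≤ Pot pos T := by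
  obtain ⟨p, q, r, s, hpq, hqr, hrs, hpr, hqs, hbal⟩ := exists_good hX hnp
  have hcr : SegCross (pos p) (pos r) (pos q) (pos s) :=
    (hX _ _ _ _ (hpq.trans hqr) (hqr.trans hrs)).2 (Or.inl ⟨hpq, hqr, hrs⟩)
  obtain ⟨c1, c2⟩ := CrE.other hpr hqs hcr
  have x1 := dep_pos pos T hpq ⟨r, c1⟩
  have y1 := dep_pos pos T hqr ⟨s, c2⟩
  have z1 := dep_pos pos T hrs ⟨p, c1.symm⟩
  have s1 := dep_add pos T hpq.le hqr.le
  have s2 := dep_add pos T hqr.le hrs.le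
  have s3 := dep_add pos T (hpq.trans hqr).le hrs.le
  have x2 : (0 : ℝ) < dep pos T p q := by exact_mod_cast x1
  have y2 : (0 : ℝ) < dep pos T q r := by exact_mod_cast y1
  have z2 : (0 : ℝ) < dep pos T r s := by exact_mod_cast z1
  obtain ⟨n1, n2⟩ := numeric x2 y2 z2 (by exact_mod_cast hbal)
  have logstep : ∀ A B C D : ℝ, 0 < A → 0 < B → 0 < C → 0 < D → 9 * (A * B) ≤ 8 * (C * D) →
      Real.log A + Real.log B + Real.log (9 / 8) ≤ Real.log C + Real.log D := by
    intro A B C D hA hB hC hD h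
    rw [← Real.log_mul hA.ne' hB.ne', ← Real.log_mul hC.ne' hD.ne',
      ← Real.log_mul (mul_pos hA hB).ne' (by norm_num)]
    exact Real.log_le_log (by positivity) (by linarith)
  have d1 : ¬ s(p, q).IsDiag := by simpa using hpq.ne
  have d2 : ¬ s(r, s).IsDiag := by simpa using hrs.ne
  have d3 : ¬ s(p, s).IsDiag := by simpa using (hpq.trans (hqr.trans hrs)).ne
  have d4 : ¬ s(q, r).IsDiag := by simpa using hqr.ne
  rcases exists_exch hT hpr hqs hpq hqr hrs with ht | ht
  · have hE := exch_edgeSet T p q r s _ _ d1 d2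
    refine ⟨_, ⟨p, r, q, s, hpr, hqs, hcr, s(p, q), s(r, s), by simp, by simp, ?_, hE, ht⟩, ht, ?_⟩
    · intro h; rw [Sym2.eq_iff] at h; grind
    · have := pot_exch hX hpq hqr hrs hpr hqs (Or.inl ⟨rfl, rfl⟩) (Or.inr (Or.inl ⟨rfl, rfl⟩)) hE
      rw [s1, s2] at this
      push_cast at this
      have := logstep _ _ _ _ x2 z2 (add_pos x2 y2) (add_pos y2 z2) n1
      linarith
  · have hE := exch_edgeSet T p q r s _ _ d3 d4
    refine ⟨_, ⟨p, r, q, s, hpr, hqs, hcr, s(p, s), s(q, r), by simp, by simp [Sym2.eq_swap], ?_,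
      hE, ht⟩, ht, ?_⟩
    · intro h; rw [Sym2.eq_iff] at h; grind
    · have := pot_exch hX hpq hqr hrs hpr hqs (Or.inr (Or.inr (Or.inl ⟨rfl, rfl⟩)))
        (Or.inr (Or.inr (Or.inr ⟨rfl, rfl⟩))) hE
      rw [s3, s1, s2] at this
      push_cast at this
      have := logstep _ _ _ _ (add_pos (add_pos x2 y2) z2) y2 (add_pos x2 y2) (add_pos y2 z2) n2
      linarith

lemma pot_nonneg (pos : V → Pt) (T : SimpleGraph V) : 0 ≤ Pot pos T :=
  Finset.sum_nonneg fun _ _ => Real.log_natCast_nonneg _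

lemma flips_of_pot {pos : V → Pt} (hX : Interl pos) (m : ℕ) : ∀ T : SimpleGraph V, T.IsTree →
    Pot pos T < (m + 1) * Real.log (9 / 8) → TreeFlipsToPlane pos T m := by
  induction m with
  | zero =>
    intro T hT h
    by_cases hp : TreePlane pos T
    · exact ⟨0, fun _ => T, le_rfl, rfl, by simp, hp⟩
    · obtain ⟨T', -, -, h'⟩ := exists_flip hX hT hp
      have := pot_nonneg pos T'
      push_cast at h
      linarith
  | succ m ih =>
    intro T hT h
    by_cases hp : TreePlane pos T
    · exact ⟨0, fun _ => T, by omega, rfl, by simp, hp⟩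
    · obtain ⟨T', hf, hT', h'⟩ := exists_flip hX hT hp
      obtain ⟨j, g, hj, h0, hg, hpl⟩ := ih T' hT' (by push_cast at h; linarith)
      refine ⟨j + 1, fun i => Nat.casesOn i T g, by omega, rfl, ?_, hpl⟩
      intro i hi
      cases i with
      | zero => simpa [h0] using hf
      | succ i => exact hg i (by omega)

lemma pot_le (pos : V → Pt) {T : SimpleGraph V} (hT : T.IsTree) :
    Pot pos T ≤ Fintype.card V * Real.log (Fintype.card V) := by
  have hcard : (CS pos T).card ≤ Fintype.card V := by
    have h1 := hT.card_edgeFinset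
    have h2 : (CS pos T).card ≤ T.edgeFinset.card := by
      refine Finset.card_le_card_of_injOn (fun e => s(e.1, e.2)) ?_ ?_
      · intro e he
        simp only [CS, Finset.coe_filter, Finset.mem_univ, true_and, Set.mem_ofPred_eq] at he
        simpa using he.2.1
      · rintro ⟨a, b⟩ he ⟨c, d⟩ hf h
        simp only [CS, Finset.coe_filter, Finset.mem_univ, true_and, Set.mem_ofPred_eq] at he hf
        simp only [Sym2.eq_iff] at h
        have := he.1
        have := hf.1
        grind
    omega
  calc Pot pos T ≤ (CS pos T).card • Real.log (Fintype.card V) :=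
        Finset.sum_le_card_nsmul _ _ _ fun e _ => logNat_mono (Finset.card_le_univ _)
    _ ≤ _ := by
        rw [nsmul_eq_mul]
        exact mul_le_mul_of_nonneg_right (by exact_mod_cast hcard) (Real.log_natCast_nonneg _)

end Comb

/-- There is a constant `c > 0` such that every geometric spanning
tree on `n ≥ 2` points in convex (and general) position can be made plane by at most
`c·n·log n` flips. -/
theorem stmt13 :
    ∃ c : ℝ, 0 < c ∧
      ∀ (n : ℕ), 2 ≤ n → ∀ P : Finset Pt, P.card = n → GenPos ↑P → ConvexPos ↑P →
        ∀ T : SimpleGraph {x : Pt // x ∈ P}, T.IsTree →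
          ∃ k : ℕ, (k : ℝ) ≤ c * n * Real.log n ∧
            TreeFlipsToPlane Subtype.val T k := by
  have hδ : 0 < Real.log (9 / 8) := Real.log_pos (by norm_num)
  refine ⟨1 / Real.log (9 / 8), by positivity, ?_⟩
  intro n hn P hP hg hc T hT
  obtain ⟨key, hinj, ho⟩ := exists_key P hg hc
  let _ : LinearOrder {x : Pt // x ∈ P} := LinearOrder.lift' key hinj
  have hX : Interl (Subtype.val : {x : Pt // x ∈ P} → Pt) := fun a b c d hab hcd =>
    segCross_iff Subtype.val Subtype.val_injective ho a b c d hab hcd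
  have hpot := pot_le (Subtype.val : {x : Pt // x ∈ P} → Pt) hT
  rw [Fintype.card_coe, hP] at hpot
  refine ⟨⌊Pot Subtype.val T / Real.log (9 / 8)⌋₊, ?_, flips_of_pot hX _ T hT ?_⟩
  · refine (Nat.floor_le (div_nonneg (pot_nonneg _ _) hδ.le)).trans ?_
    rw [div_le_iff₀ hδ]
    refine hpot.trans (le_of_eq ?_)
    field_simp
  · rw [← div_lt_iff₀ hδ]
    exact Nat.lt_floor_add_one _
end
end
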